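/- The metric g determined by the real constants a, b, p, q, s with a² + b² ≠ 0 is two-symmetric: the second covariant derivative of the curvature tensor vanishes identically, ∇_n ∇_m R^i_{jkl} = 0 for all indices and all points of ℝ⁴, while the first covariant derivative does not vanish identically, i.e. there exist indices m,i,j,k,l and a point at which ∇_m R^i_{jkl} ≠ 0. -/

import Mathlib

noncomputable section

open scoped BigOperators

/-- The metric of a four-dimensional two-symmetric Lorentzian manifold, in
coordinates `x 0 = x¹, x 1 = x², x 2 = x³, x 3 = x⁴`:
`g₁₄ = g₄₁ = g₂₂ = g₃₃ = 1`,
`g₄₄ = x⁴(a(x²)² + b(x³)²) + p(x²)² + 2q x²x³ + s(x³)²`, all others zero. -/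
def gmat (a b p q s : ℝ) (x : Fin 4 → ℝ) : Matrix (Fin 4) (Fin 4) ℝ :=
  Matrix.of fun i j =>
    if i = 0 ∧ j = 3 then 1
    else if i = 3 ∧ j = 0 then 1
    else if i = 1 ∧ j = 1 then 1
    else if i = 2 ∧ j = 2 then 1
    else if i = 3 ∧ j = 3 then
      x 3 * (a * (x 1) ^ 2 + b * (x 2) ^ 2) + p * (x 1) ^ 2
        + 2 * q * x 1 * x 2 + s * (x 2) ^ 2
    else 0

/-- The inverse matrix `g^{ij}`. -/
def ginv (a b p q s : ℝ) (x : Fin 4 → ℝ) : Matrix (Fin 4) (Fin 4) ℝ :=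
  (gmat a b p q s x)⁻¹

/-- Partial derivative `∂_i` of a function on ℝ⁴. -/
def pd (i : Fin 4) (f : (Fin 4 → ℝ) → ℝ) (x : Fin 4 → ℝ) : ℝ :=
  fderiv ℝ f x (Pi.single i 1)

/-- Christoffel symbols `Γ^k_{ij} = (1/2) Σ_l g^{kl}(∂_i g_{jl} + ∂_j g_{il} − ∂_l g_{ij})`. -/
def Gam (a b p q s : ℝ) (k i j : Fin 4) (x : Fin 4 → ℝ) : ℝ :=
  (1 / 2) * ∑ l, ginv a b p q s x k l *
    (pd i (fun y => gmat a b p q s y j l) x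
      + pd j (fun y => gmat a b p q s y i l) x
      - pd l (fun y => gmat a b p q s y i j) x)

/-- Curvature tensor
`R^i_{jkl} = ∂_k Γ^i_{lj} − ∂_l Γ^i_{kj} + Σ_m (Γ^i_{km} Γ^m_{lj} − Γ^i_{lm} Γ^m_{kj})`. -/
def Riem (a b p q s : ℝ) (i j k l : Fin 4) (x : Fin 4 → ℝ) : ℝ :=
  pd k (Gam a b p q s i l j) x - pd l (Gam a b p q s i k j) x
    + ∑ m, (Gam a b p q s i k m x * Gam a b p q s m l j x
      - Gam a b p q s i l m x * Gam a b p q s m k j x)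

/-- Ricci tensor `ρ_{jl} = Σ_i R^i_{jil}`. -/
def Ric (a b p q s : ℝ) (j l : Fin 4) (x : Fin 4 → ℝ) : ℝ :=
  ∑ i, Riem a b p q s i j i l x

/-- Covariant derivative of the curvature tensor
`∇_m R^i_{jkl} = ∂_m R^i_{jkl} + Σ_n (Γ^i_{mn} R^n_{jkl} − Γ^n_{mj} R^i_{nkl}
  − Γ^n_{mk} R^i_{jnl} − Γ^n_{ml} R^i_{jkn})`. -/
def covR (a b p q s : ℝ) (m i j k l : Fin 4) (x : Fin 4 → ℝ) : ℝ :=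
  pd m (Riem a b p q s i j k l) x
    + ∑ n, (Gam a b p q s i m n x * Riem a b p q s n j k l x
      - Gam a b p q s n m j x * Riem a b p q s i n k l x
      - Gam a b p q s n m k x * Riem a b p q s i j n l x
      - Gam a b p q s n m l x * Riem a b p q s i j k n x)

/-- Second covariant derivative `∇_n ∇_m R^i_{jkl}`: the covariant derivative of the
(1,4)-tensor `∇R` (upper index `i`, lower indices `m j k l`). -/
def covcovR (a b p q s : ℝ) (n m i j k l : Fin 4) (x : Fin 4 → ℝ) : ℝ :=
  pd n (covR a b p q s m i j k l) x
    + ∑ r, (Gam a b p q s i n r x * covR a b p q s m r j k l x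
      - Gam a b p q s r n m x * covR a b p q s r i j k l x
      - Gam a b p q s r n j x * covR a b p q s m i r k l x
      - Gam a b p q s r n k x * covR a b p q s m i j r l x
      - Gam a b p q s r n l x * covR a b p q s m i j k r x)

/-- The component `g₄₄`. -/
def waveProfile (a b p q s : ℝ) (x : Fin 4 → ℝ) : ℝ :=
  x 3 * (a * (x 1) ^ 2 + b * (x 2) ^ 2) + p * (x 1) ^ 2 + 2 * q * x 1 * x 2 + s * (x 2) ^ 2

/-- The Kronecker delta with real values. -/
def kron (i j : Fin 4) : ℝ := if i = j then 1 else 0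

lemma kron_self (i : Fin 4) : kron i i = 1 := if_pos rfl

lemma kron_of_ne {i j : Fin 4} (h : i ≠ j) : kron i j = 0 := if_neg h

/-- Half the differential of `waveProfile`. -/
def halfGrad (a b p q s : ℝ) (i : Fin 4) (x : Fin 4 → ℝ) : ℝ :=
  kron i 1 * (x 3 * a * x 1 + p * x 1 + q * x 2)
    + kron i 2 * (x 3 * b * x 2 + q * x 1 + s * x 2)
    + kron i 3 * ((a * (x 1) ^ 2 + b * (x 2) ^ 2) / 2)

/-- The symmetric bilinear form with matrix `!![u, v; v, w]` on the directions `x²`, `x³`. -/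
def screenForm (u v w : ℝ) (i j : Fin 4) : ℝ :=
  kron i 1 * (kron j 1 * u + kron j 2 * v) + kron i 2 * (kron j 1 * v + kron j 2 * w)

/-- The plane-wave curvature tensor determined by a symmetric bilinear form on `x²`, `x³`. -/
def waveCurv (u v w : ℝ) (i j k l : Fin 4) : ℝ :=
  kron i 0 * (screenForm u v w j k * kron l 3 - screenForm u v w j l * kron k 3)
    - kron j 3 * (screenForm u v w i k * kron l 3 - screenForm u v w i l * kron k 3)

lemma pd_const (i : Fin 4) (c : ℝ) (x : Fin 4 → ℝ) : pd i (fun _ => c) x = 0 := by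
  simp [pd]

lemma pd_coord (i j : Fin 4) (x : Fin 4 → ℝ) : pd i (fun y => y j) x = kron i j := by
  have := (ContinuousLinearMap.proj (R := ℝ) (φ := fun _ : Fin 4 => ℝ) j).hasFDerivAt (x := x)
  have e : fderiv ℝ (fun y : Fin 4 → ℝ => y j) x = ContinuousLinearMap.proj j := this.fderiv
  simp [pd, e, kron, Pi.single_apply, eq_comm]

section

variable {f g : (Fin 4 → ℝ) → ℝ} {x : Fin 4 → ℝ}

lemma pd_add (i : Fin 4) (hf : DifferentiableAt ℝ f x) (hg : DifferentiableAt ℝ g x) :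
    pd i (fun y => f y + g y) x = pd i f x + pd i g x := by
  simp [pd, fderiv_fun_add hf hg]

lemma pd_sub (i : Fin 4) (hf : DifferentiableAt ℝ f x) (hg : DifferentiableAt ℝ g x) :
    pd i (fun y => f y - g y) x = pd i f x - pd i g x := by
  simp [pd, fderiv_fun_sub hf hg]

lemma pd_mul (i : Fin 4) (hf : DifferentiableAt ℝ f x) (hg : DifferentiableAt ℝ g x) :
    pd i (fun y => f y * g y) x = f x * pd i g x + g x * pd i f x := by
  simp [pd, fderiv_fun_mul hf hg]

end

lemma pd_sq_coord (i j : Fin 4) (x : Fin 4 → ℝ) :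
    pd i (fun y => y j ^ 2) x = 2 * x j * kron i j := by
  simp_rw [pow_two]
  rw [pd_mul i (by fun_prop) (by fun_prop), pd_coord]
  ring

lemma pd_waveProfile (a b p q s : ℝ) (i : Fin 4) (x : Fin 4 → ℝ) :
    pd i (waveProfile a b p q s) x = 2 * halfGrad a b p q s i x := by
  unfold waveProfile halfGrad
  simp (disch := fun_prop) only [pd_add, pd_mul, pd_const, pd_coord, pd_sq_coord]
  ring

lemma differentiable_waveProfile (a b p q s : ℝ) : Differentiable ℝ (waveProfile a b p q s) := by
  unfold waveProfile
  fun_prop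

lemma differentiable_halfGrad (a b p q s : ℝ) (i : Fin 4) :
    Differentiable ℝ (halfGrad a b p q s i) := by
  unfold halfGrad
  fun_prop

lemma halfGrad_zero (a b p q s : ℝ) (x : Fin 4 → ℝ) : halfGrad a b p q s 0 x = 0 := by
  simp [halfGrad, kron]

lemma gmat_apply (a b p q s : ℝ) (x : Fin 4 → ℝ) (i j : Fin 4) :
    gmat a b p q s x i j = kron i 0 * kron j 3 + kron i 3 * kron j 0 + kron i 1 * kron j 1
      + kron i 2 * kron j 2 + kron i 3 * kron j 3 * waveProfile a b p q s x := by
  fin_cases i <;> fin_cases j <;> simp [gmat, kron, waveProfile]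

lemma pd_gmat (a b p q s : ℝ) (x : Fin 4 → ℝ) (i j k : Fin 4) :
    pd k (fun y => gmat a b p q s y i j) x
      = kron i 3 * kron j 3 * (2 * halfGrad a b p q s k x) := by
  have hd := differentiable_waveProfile a b p q s
  simp_rw [gmat_apply]
  rw [pd_add k (by fun_prop) (by fun_prop), pd_mul k (by fun_prop) (by fun_prop), pd_const,
    pd_const, pd_waveProfile]
  ring

lemma ginv_apply (a b p q s : ℝ) (x : Fin 4 → ℝ) (i j : Fin 4) :
    ginv a b p q s x i j = kron i 0 * kron j 3 + kron i 3 * kron j 0 + kron i 1 * kron j 1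
      + kron i 2 * kron j 2 - kron i 0 * kron j 0 * waveProfile a b p q s x := by
  have h : ginv a b p q s x = Matrix.of fun i j => kron i 0 * kron j 3 + kron i 3 * kron j 0
      + kron i 1 * kron j 1 + kron i 2 * kron j 2
      - kron i 0 * kron j 0 * waveProfile a b p q s x := by
    refine Matrix.inv_eq_right_inv ?_
    ext i j
    simp only [Matrix.mul_apply, gmat_apply, Matrix.of_apply, Fin.sum_univ_four]
    fin_cases i <;> fin_cases j <;> simp [kron]
  rw [h, Matrix.of_apply]

lemma Gam_eq (a b p q s : ℝ) (k i j : Fin 4) :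
    Gam a b p q s k i j = fun x =>
      kron k 0 * (kron j 3 * halfGrad a b p q s i x + kron i 3 * halfGrad a b p q s j x
          - kron i 3 * kron j 3 * halfGrad a b p q s 3 x)
        - kron i 3 * kron j 3 *
          (kron k 1 * halfGrad a b p q s 1 x + kron k 2 * halfGrad a b p q s 2 x) := by
  funext x
  simp only [Gam, pd_gmat, ginv_apply, Fin.sum_univ_four, halfGrad_zero]
  simp [kron_self, kron_of_ne]
  ring

lemma pd_halfGrad (a b p q s : ℝ) (i k : Fin 4) (x : Fin 4 → ℝ) :
    pd k (halfGrad a b p q s i) x =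
      screenForm (x 3 * a + p) q (x 3 * b + s) i k
        + kron i 3 * (kron k 1 * (a * x 1) + kron k 2 * (b * x 2))
        + kron k 3 * (kron i 1 * (a * x 1) + kron i 2 * (b * x 2)) := by
  unfold halfGrad screenForm
  simp (disch := fun_prop) only [div_eq_mul_inv, pd_add, pd_mul, pd_const, pd_coord, pd_sq_coord]
  ring

lemma pd_Gam (a b p q s : ℝ) (k i j m : Fin 4) (x : Fin 4 → ℝ) :
    pd m (Gam a b p q s k i j) x =
      kron k 0 * (kron j 3 * pd m (halfGrad a b p q s i) x
          + kron i 3 * pd m (halfGrad a b p q s j) x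
          - kron i 3 * kron j 3 * pd m (halfGrad a b p q s 3) x)
        - kron i 3 * kron j 3 *
          (kron k 1 * pd m (halfGrad a b p q s 1) x
            + kron k 2 * pd m (halfGrad a b p q s 2) x) := by
  have hd := differentiable_halfGrad a b p q s
  rw [Gam_eq]
  simp (disch := fun_prop) only [pd_add, pd_sub, pd_mul, pd_const]
  ring

lemma Riem_eq (a b p q s : ℝ) (i j k l : Fin 4) :
    Riem a b p q s i j k l = fun x => waveCurv (x 3 * a + p) q (x 3 * b + s) i j k l := by
  funext x
  simp only [Riem, pd_Gam, pd_halfGrad, Fin.sum_univ_four]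
  simp [Gam_eq, screenForm, waveCurv, halfGrad_zero, kron_self, kron_of_ne]
  ring

/-- The connection terms in the covariant derivative of a plane-wave curvature tensor cancel. -/
lemma connection_waveCurv (a b p q s u v w : ℝ) (m i j k l : Fin 4) (x : Fin 4 → ℝ) :
    ∑ n, (Gam a b p q s i m n x * waveCurv u v w n j k l
      - Gam a b p q s n m j x * waveCurv u v w i n k l
      - Gam a b p q s n m k x * waveCurv u v w i j n l
      - Gam a b p q s n m l x * waveCurv u v w i j k n) = 0 := by
  simp only [Fin.sum_univ_four, Gam_eq]
  simp [screenForm, waveCurv, halfGrad_zero, kron_self, kron_of_ne]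
  ring

lemma covR_eq (a b p q s : ℝ) (m i j k l : Fin 4) :
    covR a b p q s m i j k l = fun _ => kron m 3 * waveCurv a 0 b i j k l := by
  funext x
  simp only [covR, Riem_eq, connection_waveCurv]
  simp (disch := fun_prop) only [waveCurv, screenForm, pd_add, pd_sub, pd_mul, pd_const, pd_coord]
  ring

/-- if `a² + b² ≠ 0`, the metric is two-symmetric: `∇²R = 0` identically,
while `∇R` does not vanish identically. -/
theorem two_symmetric (a b p q s : ℝ) (h : a ^ 2 + b ^ 2 ≠ 0) :
    (∀ (x : Fin 4 → ℝ) (n m i j k l : Fin 4), covcovR a b p q s n m i j k l x = 0) ∧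
    (∃ (x : Fin 4 → ℝ) (m i j k l : Fin 4), covR a b p q s m i j k l x ≠ 0) := by
  refine ⟨fun x n m i j k l => ?_, ?_⟩
  · have hΓ : ∀ r, Gam a b p q s r n m x * kron r 3 = 0 := by
      intro r
      fin_cases r <;> simp [Gam_eq, kron]
    have hc := connection_waveCurv a b p q s a 0 b n i j k l x
    simp only [covcovR, covR_eq, pd_const, zero_add]
    calc _ = ∑ r, (kron m 3 * (Gam a b p q s i n r x * waveCurv a 0 b r j k l
            - Gam a b p q s r n j x * waveCurv a 0 b i r k l
            - Gam a b p q s r n k x * waveCurv a 0 b i j r l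
            - Gam a b p q s r n l x * waveCurv a 0 b i j k r)) := by
          refine Finset.sum_congr rfl fun r _ => ?_
          linear_combination -waveCurv a 0 b i j k l * hΓ r
      _ = 0 := by rw [← Finset.mul_sum, hc, mul_zero]
  · by_cases ha : a = 0
    · have hb : b ≠ 0 := by
        rintro rfl
        simp [ha] at h
      exact ⟨0, 3, 0, 2, 2, 3, by simpa [covR_eq, waveCurv, screenForm, kron] using hb⟩
    · exact ⟨0, 3, 0, 1, 1, 3, by simpa [covR_eq, waveCurv, screenForm, kron] using ha⟩
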